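/- Let X and Y be Bochner-integrable random elements of (L²)^p defined on a common probability space, with means μ₁ = E[X] and μ₂ = E[Y]. Define the multi-resolution projection (MRP) distance MRP(X,Y) := ∫_{L²} ∫_{ℝ^p} (E[⟪α·(X−Y), γ⟫])² dG(α) dν(γ). Then this iterated integral is well defined and MRP(X,Y) = Σ_{k=1}^p Q(μ₁ₖ − μ₂ₖ, μ₁ₖ − μ₂ₖ). -/

import Mathlib

open MeasureTheory ProbabilityTheory
open scoped RealInnerProductSpace unitInterval

noncomputable section

/-- The real Hilbert space `L²([0,1]; ℝ)`. -/
abbrev L2 : Type := MeasureTheory.Lp ℝ 2 (volume : Measure I)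

/-- `L²` carries its Borel σ-algebra. -/
instance : MeasurableSpace L2 := borel L2

instance : BorelSpace L2 := ⟨rfl⟩

/-- A linear combination of independent standardized coordinates is square integrable, and its
second moment is the sum of the squared coefficients. -/
theorem integrable_and_integral_sq_sum_mul_pi {ι : Type*} [Fintype ι]
    (G : ι → Measure ℝ) [∀ k, IsProbabilityMeasure (G k)]
    (hsq : ∀ k, Integrable (fun x : ℝ => x ^ 2) (G k))
    (hmean : ∀ k, (∫ x, x ∂G k) = 0) (hvar : ∀ k, (∫ x, x ^ 2 ∂G k) = 1) (c : ι → ℝ) :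
    Integrable (fun α : ι → ℝ => (∑ k, α k * c k) ^ 2) (Measure.pi G) ∧
      ∫ α, (∑ k, α k * c k) ^ 2 ∂Measure.pi G = ∑ k, c k ^ 2 := by
  have hL (k : ι) : MemLp (fun x : ℝ => x * c k) 2 (G k) :=
    ((memLp_two_iff_integrable_sq aestronglyMeasurable_id).2 (hsq k)).mul_const (c k)
  have hL' (k : ι) : MemLp (fun α : ι → ℝ => α k * c k) 2 (Measure.pi G) :=
    (hL k).comp_measurePreserving (measurePreserving_eval G k)
  have hsum : MemLp (fun α : ι → ℝ => ∑ k, α k * c k) 2 (Measure.pi G) :=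
    memLp_finsetSum _ fun k _ => hL' k
  have hzero (k : ι) : ∫ x, x * c k ∂G k = 0 := by
    rw [integral_mul_const, hmean, zero_mul]
  have hzero' : ∫ α, ∑ k, α k * c k ∂Measure.pi G = 0 := by
    rw [integral_finsetSum _ fun k _ => (hL' k).integrable one_le_two]
    refine Finset.sum_eq_zero fun k _ => ?_
    exact (integral_comp_eval (μ := G) (hL k).aestronglyMeasurable).trans (hzero k)
  refine ⟨hsum.integrable_sq, ?_⟩
  have hv := variance_sum_pi hL
  rw [show (∑ k, fun α : ι → ℝ => α k * c k) = fun α => ∑ k, α k * c k by ext; simp,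
    variance_of_integral_eq_zero hsum.aemeasurable hzero'] at hv
  rw [hv]
  refine Finset.sum_congr rfl fun k _ => ?_
  rw [variance_of_integral_eq_zero (hL k).aemeasurable (hzero k)]
  simp_rw [mul_pow]
  rw [integral_mul_const, hvar, one_mul]

/-- the multi-resolution projection (MRP) distance of two integrable
random elements of `(L²)^p` is well defined and has the closed form
`Σ_k Q(μ₁ₖ − μ₂ₖ, μ₁ₖ − μ₂ₖ)`. -/
theorem mrp_distance_closed_form
    {Ω : Type*} [MeasurableSpace Ω] (P : Measure Ω) [IsProbabilityMeasure P]
    (p : ℕ) (hp : 1 ≤ p)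
    (G : Fin p → Measure ℝ) [∀ k, IsProbabilityMeasure (G k)]
    (hGmom2 : ∀ k, Integrable (fun x : ℝ => x ^ 2) (G k))
    (hGint : ∀ k, Integrable (fun x : ℝ => x) (G k))
    (hGmean : ∀ k, (∫ x, x ∂G k) = 0)
    (hGvar : ∀ k, (∫ x, x ^ 2 ∂G k) = 1)
    (ν : Measure L2) [IsProbabilityMeasure ν]
    (Q : L2 →L[ℝ] L2 →L[ℝ] ℝ)
    (hQint : ∀ f g : L2, Integrable (fun γ : L2 => ⟪γ, f⟫ * ⟪γ, g⟫) ν)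
    (hQ : ∀ f g : L2, (∫ γ, ⟪γ, f⟫ * ⟪γ, g⟫ ∂ν) = Q f g)
    (X Y : Ω → (Fin p → L2))
    (hX : Integrable X P) (hY : Integrable Y P)
    (μ₁ μ₂ : Fin p → L2)
    (hμ₁ : μ₁ = ∫ ω, X ω ∂P) (hμ₂ : μ₂ = ∫ ω, Y ω ∂P) :
    (∀ (α : Fin p → ℝ) (γ : L2),
        Integrable (fun ω => ⟪∑ k, α k • (X ω k - Y ω k), γ⟫) P) ∧
    (∀ γ : L2,
        Integrable
          (fun α : Fin p → ℝ => (∫ ω, ⟪∑ k, α k • (X ω k - Y ω k), γ⟫ ∂P) ^ 2)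
          (Measure.pi G)) ∧
    Integrable
      (fun γ : L2 =>
        ∫ α, (∫ ω, ⟪∑ k, α k • (X ω k - Y ω k), γ⟫ ∂P) ^ 2 ∂Measure.pi G) ν ∧
    (∫ γ, ∫ α, (∫ ω, ⟪∑ k, α k • (X ω k - Y ω k), γ⟫ ∂P) ^ 2 ∂Measure.pi G ∂ν) =
      ∑ k, Q (μ₁ k - μ₂ k) (μ₁ k - μ₂ k) := by
  have hZ (k : Fin p) : Integrable (fun ω => X ω k - Y ω k) P := (hX.eval k).sub (hY.eval k)
  have hmean (k : Fin p) : ∫ ω, X ω k - Y ω k ∂P = μ₁ k - μ₂ k := by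
    rw [integral_sub (hX.eval k) (hY.eval k), hμ₁, hμ₂, eval_integral fun k => hX.eval k,
      eval_integral fun k => hY.eval k]
  have hsmul (α : Fin p → ℝ) (k : Fin p) : Integrable (fun ω => α k • (X ω k - Y ω k)) P :=
    (hZ k).smul (α k)
  have hcomb (α : Fin p → ℝ) : Integrable (fun ω => ∑ k, α k • (X ω k - Y ω k)) P :=
    integrable_finsetSum _ fun k _ => hsmul α k
  have hinner (α : Fin p → ℝ) (γ : L2) :
      ∫ ω, ⟪∑ k, α k • (X ω k - Y ω k), γ⟫ ∂P = ∑ k, α k * ⟪γ, μ₁ k - μ₂ k⟫ := by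
    simp_rw [real_inner_comm γ]
    rw [integral_inner (hcomb α), integral_finsetSum _ fun k _ => hsmul α k]
    simp_rw [integral_smul, hmean, inner_sum, real_inner_smul_right]
  have hpi (γ : L2) := integrable_and_integral_sq_sum_mul_pi G hGmom2 hGmean hGvar
    fun k => ⟪γ, μ₁ k - μ₂ k⟫
  have hInt (k : Fin p) := hQint (μ₁ k - μ₂ k) (μ₁ k - μ₂ k)
  refine ⟨fun α γ => (hcomb α).inner_const γ, ?_⟩
  simp_rw [hinner, (hpi _).2, sq (inner ℝ _ _)]
  refine ⟨fun γ => (hpi γ).1, integrable_finsetSum _ fun k _ => hInt k, ?_⟩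
  rw [integral_finsetSum _ fun k _ => hInt k]
  simp_rw [hQ]
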